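/- arXiv:1902.05957 — 6 statements merged into one kernel-verified Lean document; each statement's English description precedes it below -/
import Mathlib

section
/- For every n ≥ 1 and all antiperiodic binary strings μ, ν : ℤ/2n → ℤ, the integer E_{2n}(μ, ν) is odd. (Hence every matrix element ⟨ν ν̄|U₂₂|μ μ̄⟩ ∝ i^{E_{2n}(μ,ν)} of the duality symmetry in the Neveu–Schwarz odd-parity sector is purely imaginary, as claimed in the paper.) -/
instance (n : ℕ) [NeZero n] : NeZero (2 * n) :=
  ⟨Nat.mul_ne_zero two_ne_zero (NeZero.ne n)⟩

/-- `E_m(μ,ν) = Σ_{i ∈ ℤ/m} μ(i)·(ν(i+1) − ν(i))`. -/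
def Emat (m : ℕ) [NeZero m] (μ ν : ZMod m → ℤ) : ℤ :=
  ∑ i : ZMod m, μ i * (ν (i + 1) - ν i)

/-- `μ : ℤ/2n → ℤ` is an antiperiodic binary string: it takes values in `{0,1}`
and satisfies `μ(i+n) = 1 − μ(i)` for all `i`. -/
def IsAntiperiodic (n : ℕ) (μ : ZMod (2 * n) → ℤ) : Prop :=
  (∀ i, μ i = 0 ∨ μ i = 1) ∧ ∀ i, μ (i + (n : ZMod (2 * n))) = 1 - μ i

theorem ZMod.sum_univ_eq_sum_range {M : Type*} [AddCommMonoid M] (m : ℕ) [NeZero m]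
    (f : ZMod m → M) : ∑ i, f i = ∑ k ∈ Finset.range m, f k := by
  refine Finset.sum_bij' (fun i _ => i.val) (fun k _ => (k : ZMod m)) ?_ ?_ ?_ ?_ ?_
  · intro i _
    exact Finset.mem_range.2 i.val_lt
  · intro k _
    exact Finset.mem_univ _
  · intro i _
    exact ZMod.natCast_zmod_val i
  · intro k hk
    exact ZMod.val_cast_of_lt (Finset.mem_range.1 hk)
  · intro i _
    rw [ZMod.natCast_zmod_val]

/-- Folding the sum along the antiperiod and telescoping. -/
theorem Emat_antiperiodic_eq (n : ℕ) [NeZero n] (μ ν : ZMod (2 * n) → ℤ)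
    (hμ : IsAntiperiodic n μ) (hν : IsAntiperiodic n ν) :
    Emat (2 * n) μ ν =
      2 * (∑ k ∈ Finset.range n, μ k * (ν (k + 1) - ν k) + ν 0) - 1 := by
  have tele : ∑ k ∈ Finset.range n, (ν ((k : ZMod (2 * n)) + 1) - ν k) = 1 - 2 * ν 0 := by
    have h := Finset.sum_range_sub (fun k : ℕ => ν k) n
    have hn := hν.2 0
    rw [zero_add] at hn
    push_cast at h
    rw [h, hn]
    ring
  have fold (k : ℕ) : μ ((n + k : ℕ) : ZMod (2 * n)) *
      (ν (((n + k : ℕ) : ZMod (2 * n)) + 1) - ν ((n + k : ℕ) : ZMod (2 * n))) =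
      μ k * (ν (k + 1) - ν k) - (ν (k + 1) - ν k) := by
    have h : ((n + k : ℕ) : ZMod (2 * n)) = k + n := by push_cast; ring
    rw [h, add_right_comm, hμ.2, hν.2, hν.2]
    ring
  rw [Emat, ZMod.sum_univ_eq_sum_range,
    show Finset.range (2 * n) = Finset.range (n + n) by rw [two_mul], Finset.sum_range_add,
    Finset.sum_congr rfl fun k _ => fold k, Finset.sum_sub_distrib, tele]
  ring

/-- For antiperiodic binary strings `μ, ν` on `ℤ/2n`, the exponent `E_{2n}(μ,ν)` is odd;
hence every matrix element `⟨ν ν̄|U₂₂|μ μ̄⟩ ∝ i^{E_{2n}(μ,ν)}` of the duality symmetry in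
the Neveu–Schwarz odd-parity sector is purely imaginary. -/
theorem Emat_antiperiodic_odd (n : ℕ) [NeZero n] (μ ν : ZMod (2 * n) → ℤ)
    (hμ : IsAntiperiodic n μ) (hν : IsAntiperiodic n ν) :
    Odd (Emat (2 * n) μ ν) := by
  rw [Emat_antiperiodic_eq n μ ν hμ hν]
  exact Even.sub_odd (even_two_mul _) odd_one
end

section
/- For every n ≥ 1 and all antiperiodic binary strings μ, ν : ℤ/2n → ℤ, one has (in ℂ, with integer powers of the imaginary unit): i^{E_{2n}(1−μ, ν)} = − i^{E_{2n}(μ, ν)} and i^{E_{2n}(μ, 1−ν)} = − i^{E_{2n}(μ, ν)}. (This is the paper's relation ⟨ν ν̄|U₂₂|μ̄ μ⟩ = −⟨ν ν̄|U₂₂|μ μ̄⟩ = ⟨ν̄ ν|U₂₂|μ μ̄⟩·(−1).) -/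
theorem ZMod.sum_eq_sum_range {M : Type*} [AddCommMonoid M] (m : ℕ) [NeZero m] (f : ZMod m → M) :
    ∑ i, f i = ∑ k ∈ Finset.range m, f (k : ZMod m) := by
  refine Finset.sum_nbij' (fun i => i.val) (fun k => (k : ZMod m)) ?_ ?_ ?_ ?_ ?_
  · intro i _
    exact Finset.mem_range.2 (ZMod.val_lt i)
  · intro k _
    exact Finset.mem_univ _
  · intro i _
    exact ZMod.natCast_zmod_val i
  · intro k hk
    exact ZMod.val_cast_of_lt (Finset.mem_range.1 hk)
  · intro i _
    simp only [ZMod.natCast_zmod_val]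

theorem Emat_one_sub_left (m : ℕ) [NeZero m] (μ ν : ZMod m → ℤ) :
    Emat m (fun i => 1 - μ i) ν = -Emat m μ ν := by
  have hshift : ∑ i : ZMod m, ν (i + 1) = ∑ i, ν i :=
    Equiv.sum_comp (Equiv.addRight (1 : ZMod m)) ν
  simp only [Emat, sub_mul, one_mul, Finset.sum_sub_distrib, hshift, sub_self, zero_sub]

theorem Emat_one_sub_right (m : ℕ) [NeZero m] (μ ν : ZMod m → ℤ) :
    Emat m μ (fun i => 1 - ν i) = -Emat m μ ν := by
  simp only [Emat, ← Finset.sum_neg_distrib]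
  exact Finset.sum_congr rfl fun i _ => by ring

/-- Pairing `i` with `i + n` gives `Emat (2 * n) μ ν = ∑ k < n, (2 μ(k) - 1) (ν(k+1) - ν(k))`, which
is congruent modulo 2 to the telescoping sum `ν(n) - ν(0) = 1 - 2 ν(0)`. -/
theorem IsAntiperiodic.odd_Emat {n : ℕ} [NeZero n] {μ ν : ZMod (2 * n) → ℤ}
    (hν : IsAntiperiodic n ν) (hμ : IsAntiperiodic n μ) : Odd (Emat (2 * n) μ ν) := by
  have htel : ∑ k ∈ Finset.range n, (ν ((k : ZMod (2 * n)) + 1) - ν k) = 1 - 2 * ν 0 := by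
    have h := Finset.sum_range_sub (fun k : ℕ => ν (k : ZMod (2 * n))) n
    have h0 := hν.2 0
    rw [zero_add] at h0
    push_cast at h
    rw [h, h0]
    ring
  have hsplit (f : ℕ → ℤ) : ∑ k ∈ Finset.range (2 * n), f k =
      ∑ k ∈ Finset.range n, (f k + f (n + k)) := by
    rw [two_mul, Finset.sum_range_add, Finset.sum_add_distrib]
  have key : Emat (2 * n) μ ν =
      2 * ∑ k ∈ Finset.range n, (μ k - 1) * (ν (k + 1) - ν k) + (1 - 2 * ν 0) := by
    rw [Emat, ZMod.sum_eq_sum_range, hsplit, ← htel, Finset.mul_sum, ← Finset.sum_add_distrib]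
    refine Finset.sum_congr rfl fun k _ => ?_
    have hk : ((n + k : ℕ) : ZMod (2 * n)) = k + n := by push_cast; ring
    rw [hk, add_right_comm, hμ.2, hν.2, hν.2]
    ring
  rw [key]
  exact (even_two_mul _).add_odd (odd_one.sub_even (even_two_mul _))

theorem Complex.I_zpow_neg_of_odd {k : ℤ} (hk : Odd k) :
    Complex.I ^ (-k) = -(Complex.I ^ k) := by
  rw [zpow_neg, ← inv_zpow, Complex.inv_I, hk.neg_zpow]

/-- For antiperiodic binary strings `μ, ν` on `ℤ/2n`, flipping either string negates the
phase `i^{E_{2n}(μ,ν)}`; this is the relation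
`⟨ν ν̄|U₂₂|μ̄ μ⟩ = −⟨ν ν̄|U₂₂|μ μ̄⟩ = −⟨ν̄ ν|U₂₂|μ μ̄⟩`. -/
theorem Emat_flip_negates_phase (n : ℕ) [NeZero n] (μ ν : ZMod (2 * n) → ℤ)
    (hμ : IsAntiperiodic n μ) (hν : IsAntiperiodic n ν) :
    Complex.I ^ Emat (2 * n) (fun i => 1 - μ i) ν = -(Complex.I ^ Emat (2 * n) μ ν) ∧
    Complex.I ^ Emat (2 * n) μ (fun i => 1 - ν i) = -(Complex.I ^ Emat (2 * n) μ ν) := by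
  have h : Odd (Emat (2 * n) μ ν) := hν.odd_Emat hμ
  exact ⟨by rw [Emat_one_sub_left, Complex.I_zpow_neg_of_odd h],
    by rw [Emat_one_sub_right, Complex.I_zpow_neg_of_odd h]⟩
end

section
/- Closed-loop dimer-rotation lemma: in the Clifford algebra Cl of 2n Majoranas, with A = ∏_{k=1}^{n} P_{2k−1,2k}(s_{2k−1}) and B = ∏_{k=1}^{n} P_{2k,2k+1}(s_{2k}) (indices cyclic, γ_{2n+1} := γ_1), one has A·B·A = 2^{−n}·(1 − s_1 s_2 ⋯ s_{2n})·A. In particular, if the product of all 2n signs around the loop is +1 then A·B·A = 0, while if it is −1 then A·B·A = 2^{1−n}·A (so shifting the dimer cover around a closed loop annihilates the state unless the loop signs multiply to −1, in which case the norm shrinks by 2^{−(n−1)/2}). -/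
/-- The quadratic form `Q(x) = Σ_j x_j²` on `ℂ^{2n}` (indices cyclic, in `ℤ/2n`). -/
noncomputable def Qform (n : ℕ) [NeZero n] : QuadraticForm ℂ (ZMod (2 * n) → ℂ) :=
  QuadraticMap.weightedSumSquares ℂ (fun _ : ZMod (2 * n) => (1 : ℂ))

/-- The Majorana operator `γ_j`, the image of the `j`-th standard basis vector in the
Clifford algebra of `Q`; these satisfy `γ_j² = 1` and `γ_j γ_k = −γ_k γ_j` for `j ≠ k`. -/
noncomputable def γ (n : ℕ) [NeZero n] (j : ZMod (2 * n)) :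
    CliffordAlgebra (Qform n) :=
  CliffordAlgebra.ι (Qform n) (Pi.single j 1)

/-- The projector `P_{jk}(s) = (1/2)(1 + i·s·γ_j γ_k)`. -/
noncomputable def Pproj (n : ℕ) [NeZero n] (s : ℂ) (j k : ZMod (2 * n)) :
    CliffordAlgebra (Qform n) :=
  (2 : ℂ)⁻¹ • (1 + (Complex.I * s) • (γ n j * γ n k))

/-- `A = ∏_{k=1}^{n} P_{2k−1,2k}(s_{2k−1})` (here written with `0`-based cyclic indices:
the `k`-th factor, `k = 0, …, n−1`, is `P_{2k,2k+1}(s_{2k})`); the factors pairwise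
commute, so the ordered product is unambiguous. -/
noncomputable def Aop (n : ℕ) [NeZero n] (s : ZMod (2 * n) → ℂ) :
    CliffordAlgebra (Qform n) :=
  (List.ofFn (fun k : Fin n =>
    Pproj n (s ((2 * (k : ℕ) : ℕ) : ZMod (2 * n)))
      ((2 * (k : ℕ) : ℕ) : ZMod (2 * n)) ((2 * (k : ℕ) + 1 : ℕ) : ZMod (2 * n)))).prod

/-- `B = ∏_{k=1}^{n} P_{2k,2k+1}(s_{2k})` with `γ_{2n+1} := γ_1` (with `0`-based cyclic
indices: the `k`-th factor is `P_{2k+1,2k+2 mod 2n}(s_{2k+1})`); the factors pairwise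
commute, so the ordered product is unambiguous. -/
noncomputable def Bop (n : ℕ) [NeZero n] (s : ZMod (2 * n) → ℂ) :
    CliffordAlgebra (Qform n) :=
  (List.ofFn (fun k : Fin n =>
    Pproj n (s ((2 * (k : ℕ) + 1 : ℕ) : ZMod (2 * n)))
      ((2 * (k : ℕ) + 1 : ℕ) : ZMod (2 * n)) ((2 * (k : ℕ) + 2 : ℕ) : ZMod (2 * n)))).prod

namespace DimerRotation

section Abstract

variable {R : Type*} [Ring R]

/-- The ordered product `f 0 * f 1 * ⋯ * f (m - 1)`. -/
def rangeProd (f : ℕ → R) (m : ℕ) : R := ((List.range m).map f).prod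

lemma rangeProd_zero (f : ℕ → R) : rangeProd f 0 = 1 := by simp [rangeProd]

lemma rangeProd_succ (f : ℕ → R) (m : ℕ) : rangeProd f (m + 1) = rangeProd f m * f m := by
  simp [rangeProd, List.prod_range_succ]

lemma commute_rangeProd {f : ℕ → R} {x : R} {m : ℕ} (h : ∀ k < m, Commute x (f k)) :
    Commute x (rangeProd f m) := by
  induction m with
  | zero => rw [rangeProd_zero]; exact Commute.one_right x
  | succ m ih =>
    rw [rangeProd_succ]
    exact (ih fun k hk => h k (by omega)).mul_right (h m (by omega))

lemma anticommute_mul_of_commute_left {e x y : R} (hx : Commute e x) (hy : e * y = -(y * e)) :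
    e * (x * y) = -(x * y * e) := by
  rw [← mul_assoc, hx.eq, mul_assoc, hy, mul_neg, mul_assoc]

lemma anticommute_mul_of_commute_right {e x y : R} (hx : e * x = -(x * e)) (hy : Commute e y) :
    e * (x * y) = -(x * y * e) := by
  rw [← mul_assoc, hx, neg_mul, mul_assoc, hy.eq, mul_assoc]

variable [Algebra ℂ R]

/-- The operator `(1 + x) / 2`, a projector when `x` is an involution. -/
noncomputable def halfOneAdd (x : R) : R := (2 : ℂ)⁻¹ • (1 + x)

lemma commute_halfOneAdd {x y : R} (h : Commute x y) : Commute x (halfOneAdd y) :=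
  ((Commute.one_right x).add_right h).smul_right _

lemma mul_halfOneAdd_self {x : R} (h : x * x = 1) : x * halfOneAdd x = halfOneAdd x := by
  rw [halfOneAdd, mul_smul_comm, mul_add, h, mul_one, add_comm]

section Projector

variable {e : ℕ → R} {m : ℕ}

lemma mul_rangeProd_halfOneAdd (hsq : ∀ k < m, e k * e k = 1)
    (hc : ∀ j < m, ∀ k < m, Commute (e j) (e k)) {k : ℕ} (hk : k < m) :
    e k * rangeProd (fun i => halfOneAdd (e i)) m = rangeProd (fun i => halfOneAdd (e i)) m := by
  induction m with
  | zero => omega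
  | succ m ih =>
    rw [rangeProd_succ]
    rcases Nat.lt_succ_iff_lt_or_eq.mp hk with h | rfl
    · rw [← mul_assoc, ih (fun k hk => hsq k (by omega))
        (fun j hj k hk => hc j (by omega) k (by omega)) h]
    · have hcomm : Commute (e k) (rangeProd (fun i => halfOneAdd (e i)) k) :=
        commute_rangeProd fun i hi => commute_halfOneAdd (hc k hk i (by omega))
      rw [← mul_assoc, hcomm.eq, mul_assoc, mul_halfOneAdd_self (hsq k hk)]

lemma rangeProd_halfOneAdd_mul (hsq : ∀ k < m, e k * e k = 1)
    (hc : ∀ j < m, ∀ k < m, Commute (e j) (e k)) {k : ℕ} (hk : k < m) :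
    rangeProd (fun i => halfOneAdd (e i)) m * e k = rangeProd (fun i => halfOneAdd (e i)) m := by
  have hcomm : Commute (e k) (rangeProd (fun i => halfOneAdd (e i)) m) :=
    commute_rangeProd fun i hi => commute_halfOneAdd (hc k hk i hi)
  rw [← hcomm.eq, mul_rangeProd_halfOneAdd hsq hc hk]

lemma rangeProd_halfOneAdd_mul_self (hsq : ∀ k < m, e k * e k = 1)
    (hc : ∀ j < m, ∀ k < m, Commute (e j) (e k)) :
    rangeProd (fun i => halfOneAdd (e i)) m * rangeProd (fun i => halfOneAdd (e i)) m
      = rangeProd (fun i => halfOneAdd (e i)) m := by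
  have key : ∀ l ≤ m, rangeProd (fun i => halfOneAdd (e i)) m *
      rangeProd (fun i => halfOneAdd (e i)) l = rangeProd (fun i => halfOneAdd (e i)) m := by
    intro l hl
    induction l with
    | zero => rw [rangeProd_zero, mul_one]
    | succ l ih =>
      rw [rangeProd_succ, ← mul_assoc, ih (by omega), halfOneAdd, mul_smul_comm, mul_add,
        rangeProd_halfOneAdd_mul hsq hc (by omega), mul_one, ← two_smul ℂ, smul_smul]
      norm_num
  exact key m le_rfl

lemma rangeProd_mul_rangeProd_halfOneAdd (hsq : ∀ k < m, e k * e k = 1)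
    (hc : ∀ j < m, ∀ k < m, Commute (e j) (e k)) :
    rangeProd e m * rangeProd (fun i => halfOneAdd (e i)) m
      = rangeProd (fun i => halfOneAdd (e i)) m := by
  have key : ∀ l ≤ m, rangeProd e l * rangeProd (fun i => halfOneAdd (e i)) m
      = rangeProd (fun i => halfOneAdd (e i)) m := by
    intro l hl
    induction l with
    | zero => rw [rangeProd_zero, one_mul]
    | succ l ih =>
      rw [rangeProd_succ, mul_assoc, mul_rangeProd_halfOneAdd hsq hc (by omega), ih (by omega)]
  exact key m le_rfl

end Projector

/-- Compressing to an invariant subspace of `e` kills whatever anticommutes with `e`. -/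
lemma mul_mul_eq_zero_of_anticommute {A e x : R} (h₁ : A * e = A) (h₂ : e * A = A)
    (h : e * x = -(x * e)) : A * x * A = 0 := by
  have hneg : A * x * A = -(A * x * A) := by
    calc A * x * A = A * e * x * A := by rw [h₁]
      _ = A * (e * x) * A := by noncomm_ring
      _ = -(A * x * (e * A)) := by rw [h]; noncomm_ring
      _ = -(A * x * A) := by rw [h₂]
  have h2 : (2 : ℂ) • (A * x * A) = 0 := by
    rw [two_smul]; nth_rewrite 1 [hneg]; exact neg_add_cancel _
  simpa using (smul_eq_zero_iff_right (two_ne_zero (α := ℂ))).mp h2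

lemma commute_halfOneAdd_rangeProd {x : R} {d : ℕ → R} {m : ℕ} (h : ∀ k < m, Commute x (d k)) :
    Commute x (rangeProd (fun i => halfOneAdd (d i)) m) :=
  commute_rangeProd fun k hk => commute_halfOneAdd (h k hk)

section Chain

variable {A : R} {e d : ℕ → R} {n : ℕ}

lemma compress_rangeProd
    (hAe : ∀ k < n, A * e k = A) (heA : ∀ k < n, e k * A = A)
    (hcomm : ∀ j < n, ∀ k < n, 0 < k → j ≠ k → j + 1 ≠ k → Commute (e k) (d j))
    (hnext : ∀ k, k + 1 < n → e (k + 1) * d k = -(d k * e (k + 1)))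
    (hA : A * A = A) {m : ℕ} (hm : m < n) :
    A * rangeProd (fun i => halfOneAdd (d i)) m * A = ((2 : ℂ) ^ m)⁻¹ • A := by
  induction m with
  | zero => simp [rangeProd_zero, hA]
  | succ m ih =>
    have hzero : A * (rangeProd (fun i => halfOneAdd (d i)) m * d m) * A = 0 :=
      mul_mul_eq_zero_of_anticommute (hAe _ hm) (heA _ hm)
        (anticommute_mul_of_commute_left
          (commute_halfOneAdd_rangeProd fun k hk =>
            hcomm k (by omega) _ hm (by omega) (by omega) (by omega)) (hnext m hm))
    rw [rangeProd_succ, halfOneAdd, mul_smul_comm, mul_smul_comm, smul_mul_assoc, mul_add,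
      mul_one, mul_add, add_mul, hzero, ih (by omega), add_zero, smul_smul, pow_succ', mul_inv]

lemma compress_rangeProd_mul
    (hAe : ∀ k < n, A * e k = A) (heA : ∀ k < n, e k * A = A)
    (hcomm : ∀ j < n, ∀ k < n, 0 < k → j ≠ k → j + 1 ≠ k → Commute (e k) (d j))
    (hself : ∀ k < n, 0 < k → e k * d k = -(d k * e k))
    {m : ℕ} (hm : m < n) (y : R)
    (hy : ∀ k < m, 0 < k → Commute (e k) y) (hym : 0 < m → e m * y = -(y * e m)) :
    A * (rangeProd (fun i => halfOneAdd (d i)) m * y) * A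
      = ((2 : ℂ) ^ m)⁻¹ • (A * (rangeProd d m * y) * A) := by
  induction m generalizing y with
  | zero => simp [rangeProd_zero]
  | succ m ih =>
    have hzero : A * (rangeProd (fun i => halfOneAdd (d i)) m * y) * A = 0 :=
      mul_mul_eq_zero_of_anticommute (hAe _ hm) (heA _ hm)
        (anticommute_mul_of_commute_left
          (commute_halfOneAdd_rangeProd fun k hk =>
            hcomm k (by omega) _ hm (by omega) (by omega) (by omega)) (hym (by omega)))
    have hrec := ih (by omega) (d m * y)
      (fun k hk h0 => (hcomm m (by omega) k (by omega) h0 (by omega) (by omega)).mul_right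
        (hy k (by omega) h0))
      (fun h0 => anticommute_mul_of_commute_right (hself m (by omega) h0) (hy m (by omega) h0))
    rw [rangeProd_succ, rangeProd_succ, halfOneAdd, mul_assoc _ _ y, mul_assoc _ _ y, smul_mul_assoc,
      mul_smul_comm, mul_smul_comm, smul_mul_assoc, add_mul, one_mul, mul_add, mul_add, add_mul,
      hzero, hrec, zero_add, smul_smul, pow_succ', mul_inv]

lemma compress_loop
    (hAe : ∀ k < n, A * e k = A) (heA : ∀ k < n, e k * A = A)
    (hcomm : ∀ j < n, ∀ k < n, 0 < k → j ≠ k → j + 1 ≠ k → Commute (e k) (d j))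
    (hself : ∀ k < n, 0 < k → e k * d k = -(d k * e k))
    (hnext : ∀ k, k + 1 < n → e (k + 1) * d k = -(d k * e (k + 1)))
    (hA : A * A = A) (hn : 0 < n) :
    A * rangeProd (fun i => halfOneAdd (d i)) n * A
      = ((2 : ℂ) ^ n)⁻¹ • (A + A * rangeProd d n * A) := by
  obtain ⟨m, rfl⟩ : ∃ m, n = m + 1 := ⟨n - 1, by omega⟩
  have h₁ := compress_rangeProd hAe heA hcomm hnext hA (Nat.lt_succ_self m)
  have h₂ := compress_rangeProd_mul hAe heA hcomm hself (Nat.lt_succ_self m) (d m)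
    (fun k hk h0 => hcomm m (by omega) k (by omega) h0 (by omega) (by omega))
    (fun h0 => hself m (by omega) h0)
  rw [rangeProd_succ, rangeProd_succ, halfOneAdd, mul_smul_comm, mul_smul_comm, smul_mul_assoc,
    mul_add, mul_one, mul_add, add_mul, h₁, h₂, ← smul_add, smul_smul, pow_succ', mul_inv]

end Chain

/-- The dimer involution `i s_j γ_j γ_{j+1}`. -/
noncomputable def dimer (g : ℕ → R) (s : ℕ → ℂ) (j : ℕ) : R :=
  (Complex.I * s j) • (g j * g (j + 1))

section Dimer

variable {g : ℕ → R} {s : ℕ → ℂ}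

lemma dimer_mul_self {j : ℕ} (hs : s j * s j = 1) (h₁ : g j * g j = 1)
    (h₂ : g (j + 1) * g (j + 1) = 1) (h : g (j + 1) * g j = -(g j * g (j + 1))) :
    dimer g s j * dimer g s j = 1 := by
  have hg : g j * g (j + 1) * (g j * g (j + 1)) = -1 := by
    calc _ = g j * (g (j + 1) * g j) * g (j + 1) := by noncomm_ring
      _ = -((g j * g j) * (g (j + 1) * g (j + 1))) := by rw [h]; noncomm_ring
      _ = -1 := by rw [h₁, h₂, mul_one]
  have hI : Complex.I * s j * (Complex.I * s j) = -1 := by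
    linear_combination Complex.I * Complex.I * hs + Complex.I_mul_I
  rw [dimer, smul_mul_smul_comm, hg, hI, neg_smul, one_smul, neg_neg]

lemma commute_dimer {x : R} {j : ℕ} (h₁ : x * g j = -(g j * x))
    (h₂ : x * g (j + 1) = -(g (j + 1) * x)) : Commute x (dimer g s j) := by
  refine Commute.smul_right ?_ _
  change x * (g j * g (j + 1)) = g j * g (j + 1) * x
  rw [← mul_assoc, h₁, neg_mul, mul_assoc, h₂, mul_neg, neg_neg, mul_assoc]

lemma anticommute_self_dimer {j : ℕ} (h : g (j + 1) * g j = -(g j * g (j + 1))) :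
    g j * dimer g s j = -(dimer g s j * g j) := by
  rw [dimer, mul_smul_comm, smul_mul_assoc, mul_assoc, h, mul_neg, smul_neg, neg_neg]

lemma anticommute_succ_dimer {j : ℕ} (h : g (j + 1) * g j = -(g j * g (j + 1))) :
    g (j + 1) * dimer g s j = -(dimer g s j * g (j + 1)) := by
  rw [dimer, mul_smul_comm, smul_mul_assoc, ← mul_assoc, h, neg_mul, smul_neg]

lemma commute_dimer_dimer {j k : ℕ} (h₁ : Commute (g j) (dimer g s k))
    (h₂ : Commute (g (j + 1)) (dimer g s k)) : Commute (dimer g s j) (dimer g s k) :=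
  (h₁.mul_left h₂).smul_left _

lemma anticommute_dimer_dimer_of_left {j k : ℕ} (h₁ : g j * dimer g s k = -(dimer g s k * g j))
    (h₂ : Commute (g (j + 1)) (dimer g s k)) :
    dimer g s j * dimer g s k = -(dimer g s k * dimer g s j) := by
  conv_lhs => enter [1]; rw [dimer]
  conv_rhs => enter [1, 2]; rw [dimer]
  rw [smul_mul_assoc, mul_smul_comm, mul_assoc, h₂.eq, ← mul_assoc, h₁, neg_mul, smul_neg,
    mul_assoc]

lemma anticommute_dimer_dimer_of_right {j k : ℕ} (h₁ : Commute (g j) (dimer g s k))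
    (h₂ : g (j + 1) * dimer g s k = -(dimer g s k * g (j + 1))) :
    dimer g s j * dimer g s k = -(dimer g s k * dimer g s j) := by
  conv_lhs => enter [1]; rw [dimer]
  conv_rhs => enter [1, 2]; rw [dimer]
  rw [smul_mul_assoc, mul_smul_comm, mul_assoc, h₂, mul_neg, ← mul_assoc, h₁.eq, smul_neg,
    mul_assoc]

/-- Moving `γ_0` through a string of odd dimers turns it into a string of even dimers. -/
lemma mul_rangeProd_odd_dimer (m : ℕ) (hs : ∀ j, s j * s j = 1) :
    g 0 * rangeProd (fun k => dimer g s (2 * k + 1)) m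
      = (∏ j ∈ Finset.range (2 * m), s j) •
        (rangeProd (fun k => dimer g s (2 * k)) m * g (2 * m)) := by
  induction m with
  | zero => simp [rangeProd_zero]
  | succ m ih =>
    rw [rangeProd_succ, rangeProd_succ, ← mul_assoc, ih,
      show 2 * (m + 1) = 2 * m + 1 + 1 by ring, Finset.prod_range_succ, Finset.prod_range_succ,
      dimer, dimer, smul_mul_smul_comm, mul_smul_comm, smul_mul_assoc, smul_smul]
    congr 1
    · linear_combination (-(∏ j ∈ Finset.range (2 * m), s j) * s (2 * m + 1) * Complex.I)
        * hs (2 * m)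
    · noncomm_ring

variable {n : ℕ}

/-- The odd dimers around a closed loop multiply to `-∏ s_j` times the product of the even ones. -/
lemma rangeProd_odd_dimer (hn : 0 < n) (hs : ∀ j, s j * s j = 1)
    (hsq : ∀ j, g j * g j = 1)
    (hg : ∀ j < 2 * n, ∀ k < 2 * n, j ≠ k → g j * g k = -(g k * g j))
    (hloop : g (2 * n) = g 0) :
    rangeProd (fun k => dimer g s (2 * k + 1)) n
      = -((∏ j ∈ Finset.range (2 * n), s j) • rangeProd (fun k => dimer g s (2 * k)) n) := by
  have hanti : ∀ m, m < n → g 0 * rangeProd (fun k => dimer g s (2 * k)) (m + 1)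
      = -(rangeProd (fun k => dimer g s (2 * k)) (m + 1) * g 0) := by
    intro m hm
    induction m with
    | zero =>
      rw [rangeProd_succ, rangeProd_zero, one_mul]
      exact anticommute_self_dimer (hg _ (by omega) _ (by omega) (by omega))
    | succ m ih =>
      rw [rangeProd_succ]
      exact anticommute_mul_of_commute_right (ih (by omega))
        (commute_dimer (hg _ (by omega) _ (by omega) (by omega))
          (hg _ (by omega) _ (by omega) (by omega)))
  have hE := hanti (n - 1) (by omega)
  rw [Nat.sub_add_cancel hn] at hE
  have hD := mul_rangeProd_odd_dimer (g := g) n hs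
  rw [hloop] at hD
  calc rangeProd (fun k => dimer g s (2 * k + 1)) n
      = g 0 * (g 0 * rangeProd (fun k => dimer g s (2 * k + 1)) n) := by
        rw [← mul_assoc, hsq, one_mul]
    _ = (∏ j ∈ Finset.range (2 * n), s j) •
          (g 0 * rangeProd (fun k => dimer g s (2 * k)) n * g 0) := by
        rw [hD, mul_smul_comm, mul_assoc]
    _ = _ := by rw [hE, neg_mul, mul_assoc, hsq, mul_one, smul_neg]

theorem closed_loop (hn : 0 < n) (hs : ∀ j, s j * s j = 1)
    (hsq : ∀ j, g j * g j = 1)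
    (hg : ∀ j < 2 * n, ∀ k < 2 * n, j ≠ k → g j * g k = -(g k * g j))
    (hloop : g (2 * n) = g 0) :
    rangeProd (fun k => halfOneAdd (dimer g s (2 * k))) n
        * rangeProd (fun k => halfOneAdd (dimer g s (2 * k + 1))) n
        * rangeProd (fun k => halfOneAdd (dimer g s (2 * k))) n
      = (((2 : ℂ) ^ n)⁻¹ * (1 - ∏ j ∈ Finset.range (2 * n), s j)) •
        rangeProd (fun k => halfOneAdd (dimer g s (2 * k))) n := by
  have hesq : ∀ k < n, dimer g s (2 * k) * dimer g s (2 * k) = 1 := fun k hk =>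
    dimer_mul_self (hs _) (hsq _) (hsq _) (hg _ (by omega) _ (by omega) (by omega))
  have hcomm_e : ∀ j < n, ∀ k < n, Commute (dimer g s (2 * j)) (dimer g s (2 * k)) := by
    intro j hj k hk
    rcases eq_or_ne j k with rfl | hjk
    · exact Commute.refl _
    · refine commute_dimer_dimer (commute_dimer ?_ ?_) (commute_dimer ?_ ?_) <;>
        exact hg _ (by omega) _ (by omega) (by omega)
  have hg' : ∀ j < 2 * n, 0 < j → ∀ k ≤ 2 * n, j ≠ k → g j * g k = -(g k * g j) := by
    intro j hj h0 k hk hjk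
    rcases hk.lt_or_eq with h | rfl
    · exact hg j hj k h hjk
    · rw [hloop]
      exact hg j hj 0 (by omega) (by omega)
  have hA := rangeProd_halfOneAdd_mul_self hesq hcomm_e
  have hAe := fun k hk => rangeProd_halfOneAdd_mul hesq hcomm_e (k := k) hk
  have heA := fun k hk => mul_rangeProd_halfOneAdd hesq hcomm_e (k := k) hk
  rw [compress_loop (d := fun k => dimer g s (2 * k + 1)) hAe heA ?_ ?_ ?_ hA hn,
    rangeProd_odd_dimer hn hs hsq hg hloop, mul_neg, neg_mul, mul_smul_comm, smul_mul_assoc,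
    mul_assoc, rangeProd_mul_rangeProd_halfOneAdd hesq hcomm_e, hA, mul_smul, sub_smul, one_smul,
    sub_eq_add_neg]
  · intro j hj k hk h0 hjk hjk'
    refine commute_dimer_dimer (commute_dimer ?_ ?_) (commute_dimer ?_ ?_) <;>
      exact hg' _ (by omega) (by omega) _ (by omega) (by omega)
  · intro k hk h0
    refine anticommute_dimer_dimer_of_right (commute_dimer ?_ ?_) (anticommute_self_dimer ?_)
    · exact hg' _ (by omega) (by omega) _ (by omega) (by omega)
    · exact hg' _ (by omega) (by omega) _ (by omega) (by omega)
    · rw [hg' (2 * k + 1) (by omega) (by omega) (2 * k + 1 + 1) (by omega) (by omega), neg_neg]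
  · intro k hk
    change dimer g s (2 * k + 1 + 1) * dimer g s (2 * k + 1)
      = -(dimer g s (2 * k + 1) * dimer g s (2 * k + 1 + 1))
    refine anticommute_dimer_dimer_of_left (anticommute_succ_dimer ?_) (commute_dimer ?_ ?_) <;>
      exact hg' _ (by omega) (by omega) _ (by omega) (by omega)

end Dimer

end Abstract

lemma γ_mul_self (n : ℕ) [NeZero n] (j : ZMod (2 * n)) : γ n j * γ n j = 1 := by
  rw [γ, CliffordAlgebra.ι_sq_scalar, Qform, QuadraticMap.weightedSumSquares_apply]
  simp [Pi.single_apply]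

lemma γ_mul_γ (n : ℕ) [NeZero n] {j k : ZMod (2 * n)} (h : j ≠ k) :
    γ n j * γ n k = -(γ n k * γ n j) := by
  rw [γ, γ]
  refine CliffordAlgebra.ι_mul_ι_comm_of_isOrtho ?_
  rw [QuadraticMap.isOrtho_def, Qform]
  simp only [QuadraticMap.weightedSumSquares_apply, ← Finset.sum_add_distrib]
  refine Finset.sum_congr rfl fun i _ => ?_
  rcases eq_or_ne i j with rfl | hi
  · simp [h]
  · simp [Pi.single_apply, hi]

lemma ofFn_prod_eq_rangeProd {R : Type*} [Ring R] (f : ℕ → R) (n : ℕ) :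
    (List.ofFn fun k : Fin n => f k).prod = rangeProd f n := by
  simp [rangeProd, List.ofFn_eq_map, ← List.map_coe_finRange_eq_range, Function.comp_def]

lemma prod_zmod_eq_prod_range {M : Type*} [CommMonoid M] (m : ℕ) [NeZero m] (s : ZMod m → M) :
    ∏ j : ZMod m, s j = ∏ j ∈ Finset.range m, s (j : ZMod m) := by
  refine Finset.prod_bij' (fun j _ => j.val) (fun j _ => (j : ZMod m)) ?_ ?_ ?_ ?_ ?_
  · exact fun j _ => Finset.mem_range.mpr j.val_lt
  · exact fun j _ => Finset.mem_univ _
  · exact fun j _ => ZMod.natCast_zmod_val j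
  · exact fun j hj => ZMod.val_cast_of_lt (Finset.mem_range.mp hj)
  · intro j _
    rw [ZMod.natCast_zmod_val]

end DimerRotation

/-- Closed-loop dimer-rotation lemma: `A·B·A = 2^{−n}·(1 − s_1 s_2 ⋯ s_{2n})·A`.
In particular, if the product of all `2n` signs around the loop is `+1` then
`A·B·A = 0`, while if it is `−1` then `A·B·A = 2^{1−n}·A`. -/
theorem closed_loop_dimer_rotation (n : ℕ) [NeZero n] (s : ZMod (2 * n) → ℂ)
    (hs : ∀ j, s j = 1 ∨ s j = -1) :
    Aop n s * Bop n s * Aop n s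
      = (((2 : ℂ) ^ n)⁻¹ * (1 - ∏ j : ZMod (2 * n), s j)) • Aop n s := by
  have h := DimerRotation.closed_loop (g := fun j : ℕ => γ n j) (s := fun j : ℕ => s j)
    (n := n) (NeZero.pos n) (fun j => by rcases hs j with h | h <;> simp [h])
    (fun j => DimerRotation.γ_mul_self n j)
    (fun j hj k hk hjk => DimerRotation.γ_mul_γ n fun h => hjk ?_) ?_
  · rw [← DimerRotation.ofFn_prod_eq_rangeProd, ← DimerRotation.ofFn_prod_eq_rangeProd] at h
    rw [DimerRotation.prod_zmod_eq_prod_range]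
    exact h
  · rw [← ZMod.val_cast_of_lt hj, ← ZMod.val_cast_of_lt hk, h]
  · simp only [ZMod.natCast_self, Nat.cast_zero]
end

section
/- Open-string dimer-shift norm lemma: in the Clifford algebra Cl of 2n Majoranas, with A = ∏_{k=1}^{n} P_{2k−1,2k}(s_{2k−1}) and B' = ∏_{k=1}^{n−1} P_{2k,2k+1}(s_{2k}) (an empty product for n = 1), one has A·B'·A = 2^{−(n−1)}·A (so shifting the dimer cover along an open string of 2n Majoranas shrinks the norm of a state in the image of A by exactly 2^{−(n−1)/2}). -/
/-- `B' = ∏_{k=1}^{n−1} P_{2k,2k+1}(s_{2k})` (with `0`-based indices: the `k`-th factor,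
`k = 0, …, n−2`, is `P_{2k+1,2k+2}(s_{2k+1})`; an empty product for `n = 1`); the factors
pairwise commute, so the ordered product is unambiguous. -/
noncomputable def Bop' (n : ℕ) [NeZero n] (s : ZMod (2 * n) → ℂ) :
    CliffordAlgebra (Qform n) :=
  (List.ofFn (fun k : Fin (n - 1) =>
    Pproj n (s ((2 * (k : ℕ) + 1 : ℕ) : ZMod (2 * n)))
      ((2 * (k : ℕ) + 1 : ℕ) : ZMod (2 * n)) ((2 * (k : ℕ) + 2 : ℕ) : ZMod (2 * n)))).prod

/-- If `x` and `y` are anticommuting involutions, the projectors `p = (1 + x)/2` and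
`q = (1 + y)/2` satisfy `p q p = p / 2`. -/
theorem half_one_add_mul_mul_of_anticomm {R : Type*} [Ring R] [Algebra ℂ R] {x y : R}
    (hx : x * x = 1) (hxy : x * y = -(y * x)) :
    ((2 : ℂ)⁻¹ • (1 + x)) * ((2 : ℂ)⁻¹ • (1 + y)) * ((2 : ℂ)⁻¹ • (1 + x)) =
      (2 : ℂ)⁻¹ • ((2 : ℂ)⁻¹ • (1 + x)) := by
  have hxyx : x * y * x = -y := by rw [hxy, neg_mul, mul_assoc, hx, mul_one]
  have key : (1 + x) * (1 + y) * (1 + x) = (2 : ℂ) • (1 + x) := by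
    rw [two_smul]
    calc (1 + x) * (1 + y) * (1 + x)
        = 1 + x + x + x * x + y + y * x + x * y + x * y * x := by noncomm_ring
      _ = 1 + x + (1 + x) := by rw [hxyx, hxy, hx]; abel
  simp only [smul_mul_assoc, mul_smul_comm, key, smul_smul]
  norm_num

/-- If `x` is an involution then `(1 + x)/2` is idempotent. -/
theorem isIdempotentElem_half_one_add {R : Type*} [Ring R] [Algebra ℂ R] {x : R}
    (hx : x * x = 1) : IsIdempotentElem ((2 : ℂ)⁻¹ • (1 + x)) := by
  have key : (1 + x) * (1 + x) = (2 : ℂ) • (1 + x) := by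
    rw [two_smul, mul_add, add_mul, add_mul, hx]
    simp only [one_mul, mul_one]
    abel
  rw [IsIdempotentElem]
  simp only [smul_mul_assoc, mul_smul_comm, key, smul_smul]
  norm_num

section Majorana

variable (n : ℕ) [NeZero n]

theorem γ_mul_self (j : ZMod (2 * n)) : γ n j * γ n j = 1 := by
  rw [γ, CliffordAlgebra.ι_sq_scalar, Qform, QuadraticMap.weightedSumSquares_apply,
    Finset.sum_eq_single j]
  · simp
  · intro b _ hb
    simp [Pi.single_eq_of_ne hb]
  · simp

theorem γ_mul_γ_of_ne {j k : ZMod (2 * n)} (h : j ≠ k) :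
    γ n j * γ n k = -(γ n k * γ n j) := by
  rw [eq_neg_iff_add_eq_zero, γ, γ, CliffordAlgebra.ι_mul_ι_add_swap]
  have hpolar : QuadraticMap.polar (Qform n) (Pi.single j 1) (Pi.single k 1) = 0 := by
    simp only [QuadraticMap.polar, Qform, QuadraticMap.weightedSumSquares_apply,
      ← Finset.sum_sub_distrib]
    refine Finset.sum_eq_zero fun b _ => ?_
    by_cases hb : b = j
    · subst hb
      simp [Pi.single_eq_of_ne h]
    · simp [Pi.single_eq_of_ne hb]
  rw [hpolar, map_zero]

theorem dimer_mul_self {j k : ZMod (2 * n)} (h : j ≠ k) {s : ℂ} (hs : s = 1 ∨ s = -1) :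
    ((Complex.I * s) • (γ n j * γ n k)) * ((Complex.I * s) • (γ n j * γ n k)) = 1 := by
  have hγ : γ n j * γ n k * (γ n j * γ n k) = -1 := by
    calc γ n j * γ n k * (γ n j * γ n k) = γ n j * (γ n k * γ n j) * γ n k := by noncomm_ring
      _ = -((γ n j * γ n j) * (γ n k * γ n k)) := by
        rw [γ_mul_γ_of_ne n h.symm]; noncomm_ring
      _ = -1 := by rw [γ_mul_self, γ_mul_self, one_mul]
  have hc : Complex.I * s * (Complex.I * s) = -1 := by
    rcases hs with rfl | rfl <;> simp
  rw [smul_mul_assoc, mul_smul_comm, smul_smul, hγ, hc, smul_neg, neg_smul, one_smul, neg_neg]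

theorem dimer_anticomm {i j k : ZMod (2 * n)} (hij : i ≠ j) (hjk : j ≠ k) (hik : i ≠ k)
    (a b : ℂ) :
    (a • (γ n j * γ n k)) * (b • (γ n i * γ n j)) =
      -((b • (γ n i * γ n j)) * (a • (γ n j * γ n k))) := by
  have hγ : γ n j * γ n k * (γ n i * γ n j) = -(γ n i * γ n j * (γ n j * γ n k)) := by
    calc γ n j * γ n k * (γ n i * γ n j) = γ n j * (γ n k * γ n i) * γ n j := by noncomm_ring
      _ = -((γ n j * γ n i) * (γ n k * γ n j)) := by
        rw [γ_mul_γ_of_ne n hik.symm]; noncomm_ring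
      _ = -(γ n i * γ n j * (γ n j * γ n k)) := by
        rw [γ_mul_γ_of_ne n hij.symm, γ_mul_γ_of_ne n hjk.symm]; noncomm_ring
  simp only [smul_mul_assoc, mul_smul_comm, hγ, smul_neg, smul_comm a b]

theorem isIdempotentElem_Pproj {j k : ZMod (2 * n)} (h : j ≠ k) {s : ℂ}
    (hs : s = 1 ∨ s = -1) : IsIdempotentElem (Pproj n s j k) :=
  isIdempotentElem_half_one_add (dimer_mul_self n h hs)

/-- Projectors on dimers sharing exactly one site satisfy a Temperley–Lieb relation. -/
theorem Pproj_mul_mul_of_adjacent {i j k : ZMod (2 * n)} (hij : i ≠ j) (hjk : j ≠ k)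
    (hik : i ≠ k) {s t : ℂ} (hs : s = 1 ∨ s = -1) :
    Pproj n s j k * Pproj n t i j * Pproj n s j k = (2 : ℂ)⁻¹ • Pproj n s j k :=
  half_one_add_mul_mul_of_anticomm (dimer_mul_self n hjk hs)
    (dimer_anticomm n hij hjk hik _ _)

theorem Pproj_commute_of_disjoint {i j k l : ZMod (2 * n)} (hik : i ≠ k) (hil : i ≠ l)
    (hjk : j ≠ k) (hjl : j ≠ l) (s t : ℂ) :
    Commute (Pproj n s i j) (Pproj n t k l) := by
  have hγ : Commute (γ n i * γ n j) (γ n k * γ n l) := by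
    have step : ∀ {m : ZMod (2 * n)}, m ≠ k → m ≠ l → Commute (γ n m) (γ n k * γ n l) := by
      intro m hk hl
      rw [Commute, SemiconjBy, ← mul_assoc, γ_mul_γ_of_ne n hk, neg_mul, mul_assoc,
        γ_mul_γ_of_ne n hl, mul_neg, neg_neg, mul_assoc]
    exact (step hik hil).mul_left (step hjk hjl)
  unfold Pproj
  refine Commute.smul_left (Commute.smul_right ?_ _) _
  exact (Commute.one_left _).add_left
    ((Commute.one_right _).add_right ((hγ.smul_left _).smul_right _))

theorem natCast_zmod_ne {N a b : ℕ} (ha : a < N) (hb : b < N) (h : a ≠ b) :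
    (a : ZMod N) ≠ (b : ZMod N) := by
  rwa [Ne, ZMod.natCast_eq_natCast_iff', Nat.mod_eq_of_lt ha, Nat.mod_eq_of_lt hb]

/-- The projector on the dimer of the neighbouring sites `j` and `j + 1`. -/
noncomputable def dimerProj (s : ZMod (2 * n) → ℂ) (j : ℕ) : CliffordAlgebra (Qform n) :=
  Pproj n (s (j : ZMod (2 * n))) (j : ZMod (2 * n)) ((j + 1 : ℕ) : ZMod (2 * n))

variable {n}

theorem dimerProj_commute (s : ZMod (2 * n) → ℂ) {i j : ℕ} (hij : i + 1 < j)
    (hj : j + 1 < 2 * n) : Commute (dimerProj n s j) (dimerProj n s i) := by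
  apply Pproj_commute_of_disjoint <;> apply natCast_zmod_ne <;> omega

theorem dimerProj_mul_mul (s : ZMod (2 * n) → ℂ) (hs : ∀ j, s j = 1 ∨ s j = -1) {j : ℕ}
    (hj : j + 2 < 2 * n) :
    dimerProj n s (j + 1) * dimerProj n s j * dimerProj n s (j + 1) =
      (2 : ℂ)⁻¹ • dimerProj n s (j + 1) := by
  apply Pproj_mul_mul_of_adjacent _ _ _ _ (hs _) <;> apply natCast_zmod_ne <;> omega

theorem dimerProj_prod_shift (s : ZMod (2 * n) → ℂ) (hs : ∀ j, s j = 1 ∨ s j = -1) (m : ℕ)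
    (hm : m + 1 ≤ n) :
    ((List.range (m + 1)).map fun k => dimerProj n s (2 * k)).prod *
        ((List.range m).map fun k => dimerProj n s (2 * k + 1)).prod *
        ((List.range (m + 1)).map fun k => dimerProj n s (2 * k)).prod =
      ((2 : ℂ) ^ m)⁻¹ • ((List.range (m + 1)).map fun k => dimerProj n s (2 * k)).prod := by
  induction m with
  | zero =>
    have h : IsIdempotentElem (dimerProj n s 0) :=
      isIdempotentElem_Pproj n (natCast_zmod_ne (by omega) (by omega) (by omega)) (hs _)
    simpa using h.eq
  | succ m ih =>
    rw [List.prod_range_succ _ (m + 1), List.prod_range_succ (fun k => dimerProj n s (2 * k + 1))]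
    set A := ((List.range (m + 1)).map fun k => dimerProj n s (2 * k)).prod
    set B := ((List.range m).map fun k => dimerProj n s (2 * k + 1)).prod
    set p := dimerProj n s (2 * (m + 1))
    set q := dimerProj n s (2 * m + 1)
    have hpA : Commute p A := by
      refine Commute.list_prod_right _ _ fun x hx => ?_
      obtain ⟨k, hk, rfl⟩ := List.mem_map.mp hx
      have := List.mem_range.mp hk
      exact dimerProj_commute s (by omega) (by omega)
    have hpB : Commute p B := by
      refine Commute.list_prod_right _ _ fun x hx => ?_
      obtain ⟨k, hk, rfl⟩ := List.mem_map.mp hx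
      have := List.mem_range.mp hk
      exact dimerProj_commute s (by omega) (by omega)
    have hpqp : p * q * p = (2 : ℂ)⁻¹ • p := dimerProj_mul_mul s hs (j := 2 * m + 1) (by omega)
    calc A * p * (B * q) * (A * p) = A * (p * B) * q * (A * p) := by simp only [mul_assoc]
      _ = A * B * (p * q * p) * A := by rw [hpB.eq, ← hpA.eq]; simp only [mul_assoc]
      _ = (2 : ℂ)⁻¹ • (A * B * (p * A)) := by
        rw [hpqp, mul_smul_comm, smul_mul_assoc, mul_assoc (A * B)]
      _ = (2 : ℂ)⁻¹ • (A * B * A * p) := by rw [hpA.eq, ← mul_assoc (A * B)]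
      _ = ((2 : ℂ) ^ (m + 1))⁻¹ • (A * p) := by
        rw [ih (by omega), smul_mul_assoc, smul_smul, pow_succ, mul_inv_rev]

theorem Aop_eq_prod_range (s : ZMod (2 * n) → ℂ) :
    Aop n s = ((List.range n).map fun k => dimerProj n s (2 * k)).prod := by
  rw [Aop, ← List.map_coe_finRange_eq_range, List.map_map, ← List.ofFn_eq_map]
  rfl

theorem Bop'_eq_prod_range (s : ZMod (2 * n) → ℂ) :
    Bop' n s = ((List.range (n - 1)).map fun k => dimerProj n s (2 * k + 1)).prod := by
  rw [Bop', ← List.map_coe_finRange_eq_range, List.map_map, ← List.ofFn_eq_map]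
  rfl

end Majorana

/-- Open-string dimer-shift norm lemma: `A·B'·A = 2^{−(n−1)}·A`, i.e. shifting the dimer
cover along an open string of `2n` Majoranas shrinks the norm of a state in the image of
`A` by exactly `2^{−(n−1)/2}`. -/
theorem open_string_dimer_shift (n : ℕ) [NeZero n] (s : ZMod (2 * n) → ℂ)
    (hs : ∀ j, s j = 1 ∨ s j = -1) :
    Aop n s * Bop' n s * Aop n s = (((2 : ℂ) ^ (n - 1))⁻¹) • Aop n s := by
  have h := dimerProj_prod_shift s hs (n - 1) (by have := NeZero.pos n; omega)
  rwa [Nat.sub_add_cancel (NeZero.pos n), ← Aop_eq_prod_range, ← Bop'_eq_prod_range] at h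
end

section
/- Fusion-channel lemma for the endpoint Majoranas of an open string: in the Clifford algebra Cl of 2n Majoranas, with A = ∏_{k=1}^{n} P_{2k−1,2k}(s_{2k−1}), B' = ∏_{k=1}^{n−1} P_{2k,2k+1}(s_{2k}), and s* = −(s_1 s_2 ⋯ s_{2n−1}), one has (i·s*·γ_{2n} γ_1)·B'·A = B'·A. (After shifting the dimer cover along the open string, the two newly unpaired Majoranas γ_1 and γ_{2n} are fused in the channel i·s*·γ_{2n}γ_1 = 1, i.e. so as to respect the Kasteleyn orientation, as the paper asserts.) -/
/-- The first `N` terms of `g` square to one and pairwise anticommute. -/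
structure IsMajoranaFamily {R : Type*} [Ring R] (g : ℕ → R) (N : ℕ) : Prop where
  sq : ∀ j < N, g j * g j = 1
  anti : ∀ j < N, ∀ k < N, j ≠ k → g j * g k = -(g k * g j)

/-- The bilinear `i·s·x·y`. -/
noncomputable def majoranaBilinear {R : Type*} [Ring R] [Algebra ℂ R] (s : ℂ) (x y : R) : R :=
  (Complex.I * s) • (x * y)

/-- The operator `(1/2)(1 + i·s·x·y)`. -/
noncomputable def fusionProj {R : Type*} [Ring R] [Algebra ℂ R] (s : ℂ) (x y : R) : R :=
  (2 : ℂ)⁻¹ • (1 + majoranaBilinear s x y)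

theorem Commute.mul_mul_of_anticommute {R : Type*} [Ring R] {a b c d : R}
    (hac : a * c = -(c * a)) (had : a * d = -(d * a))
    (hbc : b * c = -(c * b)) (hbd : b * d = -(d * b)) :
    Commute (a * b) (c * d) := by
  have hb : b * (c * d) = c * d * b := by
    rw [← mul_assoc, hbc, neg_mul, mul_assoc, hbd, mul_neg, neg_neg, mul_assoc]
  have ha : a * (c * d) = c * d * a := by
    rw [← mul_assoc, hac, neg_mul, mul_assoc, had, mul_neg, neg_neg, mul_assoc]
  rw [Commute, SemiconjBy, mul_assoc, hb, ← mul_assoc, ha, mul_assoc]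

section Algebra

variable {R : Type*} [Ring R] [Algebra ℂ R]

theorem Commute.fusionProj_right {x y z : R} (h : Commute z (x * y)) (s : ℂ) :
    Commute z (fusionProj s x y) :=
  ((Commute.one_right z).add_right (h.smul_right _)).smul_right _

theorem majoranaBilinear_mul_self {s : ℂ} {x y : R} (hs : s * s = 1) (hx : x * x = 1)
    (hy : y * y = 1) (hxy : x * y = -(y * x)) :
    majoranaBilinear s x y * majoranaBilinear s x y = 1 := by
  have h : x * y * (x * y) = -1 := by
    rw [← mul_assoc, mul_assoc x y x, ← neg_eq_iff_eq_neg.mpr hxy, mul_neg, ← mul_assoc, hx,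
      one_mul, neg_mul, hy]
  have hc : Complex.I * s * (Complex.I * s) = -1 := by
    linear_combination s * s * Complex.I_mul_I - hs
  rw [majoranaBilinear, smul_mul_smul_comm, h, hc, neg_smul, one_smul, neg_neg]

theorem fusionProj_mul_bilinear {s : ℂ} {x y : R}
    (h : majoranaBilinear s x y * majoranaBilinear s x y = 1) :
    fusionProj s x y * majoranaBilinear s x y = fusionProj s x y := by
  rw [fusionProj, smul_mul_assoc, add_mul, one_mul, h, add_comm]

theorem bilinear_mul_fusionProj {s : ℂ} {x y : R}
    (h : majoranaBilinear s x y * majoranaBilinear s x y = 1) :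
    majoranaBilinear s x y * fusionProj s x y = fusionProj s x y := by
  rw [fusionProj, mul_smul_comm, mul_add, mul_one, h, add_comm]

theorem majoranaBilinear_mul_mul {a b c d : R} {v w u : ℂ} (hv : v * v = 1) (hu : u * u = 1)
    (ha : a * a = 1) (hd : d * d = 1) (hdc : d * c = -(c * d)) (hac : a * c = -(c * a))
    (hcb : c * b = -(b * c)) :
    majoranaBilinear (v * w * u) a d * majoranaBilinear u c d * majoranaBilinear v a b =
      majoranaBilinear w b c := by
  have h₁ : a * d * (c * d) = c * a := by
    rw [← mul_assoc, mul_assoc a d c, hdc, mul_neg, neg_mul, mul_assoc, mul_assoc, hd, mul_one,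
      hac, neg_neg]
  have h₂ : c * a * (a * b) = -(b * c) := by
    rw [← mul_assoc, mul_assoc c a a, ha, mul_one, hcb]
  have hc : Complex.I * (v * w * u) * (Complex.I * u) * (Complex.I * v) = -(Complex.I * w) := by
    linear_combination Complex.I * (v * v) * w * (u * u) * Complex.I_mul_I
      - Complex.I * w * (u * u) * hv - Complex.I * w * hu
  simp only [majoranaBilinear]
  rw [smul_mul_smul_comm, smul_mul_smul_comm, h₁, h₂, hc, smul_neg, neg_smul, neg_neg]

variable {g : ℕ → R} {N : ℕ}

theorem IsMajoranaFamily.commute_fusionProj (hg : IsMajoranaFamily g N) (s : ℂ) {a b c d : ℕ}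
    (ha : a < N) (hb : b < N) (hc : c < N) (hd : d < N)
    (hac : a ≠ c) (had : a ≠ d) (hbc : b ≠ c) (hbd : b ≠ d) :
    Commute (g a * g b) (fusionProj s (g c) (g d)) :=
  (Commute.mul_mul_of_anticommute (hg.anti a ha c hc hac) (hg.anti a ha d hd had)
    (hg.anti b hb c hc hbc) (hg.anti b hb d hd hbd)).fusionProj_right s

/-- The product of the first `m` fusion projectors on the pairs `{2k, 2k+1}`. -/
noncomputable def evenProjProd (g : ℕ → R) (s : ℕ → ℂ) (m : ℕ) : R :=
  (List.ofFn fun k : Fin m => fusionProj (s (2 * k)) (g (2 * k)) (g (2 * k + 1))).prod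

/-- The product of the first `m` fusion projectors on the pairs `{2k+1, 2k+2}`. -/
noncomputable def oddProjProd (g : ℕ → R) (s : ℕ → ℂ) (m : ℕ) : R :=
  (List.ofFn fun k : Fin m => fusionProj (s (2 * k + 1)) (g (2 * k + 1)) (g (2 * k + 2))).prod

theorem evenProjProd_succ (g : ℕ → R) (s : ℕ → ℂ) (m : ℕ) :
    evenProjProd g s (m + 1) =
      evenProjProd g s m * fusionProj (s (2 * m)) (g (2 * m)) (g (2 * m + 1)) := by
  rw [evenProjProd, List.ofFn_succ_last]
  simp [evenProjProd]

theorem oddProjProd_succ (g : ℕ → R) (s : ℕ → ℂ) (m : ℕ) :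
    oddProjProd g s (m + 1) =
      oddProjProd g s m * fusionProj (s (2 * m + 1)) (g (2 * m + 1)) (g (2 * m + 2)) := by
  rw [oddProjProd, List.ofFn_succ_last]
  simp [oddProjProd]

theorem IsMajoranaFamily.commute_evenProjProd (hg : IsMajoranaFamily g N) (s : ℕ → ℂ)
    {m a b : ℕ} (ha : a < N) (hb : b < N) (hma : 2 * m ≤ a) (hmb : 2 * m ≤ b) :
    Commute (g a * g b) (evenProjProd g s m) := by
  refine Commute.list_prod_right _ _ fun x hx => ?_
  obtain ⟨k, rfl⟩ := List.mem_ofFn.mp hx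
  apply hg.commute_fusionProj <;> omega

theorem IsMajoranaFamily.commute_oddProjProd (hg : IsMajoranaFamily g N) (s : ℕ → ℂ)
    {m a b : ℕ} (ha : a < N) (hb : b < N) (hma : a = 0 ∨ 2 * m < a) (hmb : 2 * m < b) :
    Commute (g a * g b) (oddProjProd g s m) := by
  refine Commute.list_prod_right _ _ fun x hx => ?_
  obtain ⟨k, rfl⟩ := List.mem_ofFn.mp hx
  apply hg.commute_fusionProj <;> omega

/-- Fusion of the endpoints of an open string of `2m + 2` Majoranas. -/
theorem IsMajoranaFamily.bilinear_mul_oddProjProd_mul_evenProjProd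
    (hg : IsMajoranaFamily g N) {s : ℕ → ℂ} (hs : ∀ j, s j * s j = 1) (m : ℕ)
    (hm : 2 * m + 1 < N) :
    majoranaBilinear (∏ j ∈ Finset.range (2 * m + 1), s j) (g 0) (g (2 * m + 1)) *
        (oddProjProd g s m * evenProjProd g s (m + 1)) =
      oddProjProd g s m * evenProjProd g s (m + 1) := by
  have hZ (j : ℕ) (hj : j + 1 < N) :
      majoranaBilinear (s j) (g j) (g (j + 1)) * majoranaBilinear (s j) (g j) (g (j + 1)) = 1 :=
    majoranaBilinear_mul_self (hs j) (hg.sq _ (by omega)) (hg.sq _ hj)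
      (hg.anti _ (by omega) _ hj (by omega))
  induction m with
  | zero =>
    simpa [oddProjProd, evenProjProd] using bilinear_mul_fusionProj (hZ 0 hm)
  | succ m ih =>
    have ih := ih (by omega)
    rw [oddProjProd_succ, evenProjProd_succ g s (m + 1)]
    simp only [mul_add, mul_one, add_assoc, Nat.reduceAdd] at ih hm ⊢
    have hprod : ∏ j ∈ Finset.range (2 * m + 3), s j =
        (∏ j ∈ Finset.range (2 * m + 1), s j) * s (2 * m + 1) * s (2 * m + 2) := by
      rw [Finset.prod_range_succ, Finset.prod_range_succ]
    have hkey := majoranaBilinear_mul_mul (a := g 0) (b := g (2 * m + 1)) (c := g (2 * m + 2))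
      (d := g (2 * m + 3)) (v := ∏ j ∈ Finset.range (2 * m + 1), s j) (w := s (2 * m + 1))
      (by rw [← Finset.prod_mul_distrib]; exact Finset.prod_eq_one fun j _ => hs j)
      (hs (2 * m + 2)) (hg.sq _ (by omega)) (hg.sq _ (by omega))
      (hg.anti _ (by omega) _ (by omega) (by omega))
      (hg.anti _ (by omega) _ (by omega) (by omega))
      (hg.anti _ (by omega) _ (by omega) (by omega))
    rw [← hprod] at hkey
    have hPo : Commute (oddProjProd g s m)
        (fusionProj (s (2 * m + 1)) (g (2 * m + 1)) (g (2 * m + 2))) :=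
      (hg.commute_oddProjProd s (by omega) (by omega) (by omega) (by omega)).symm.fusionProj_right _
    have hPe : Commute (oddProjProd g s m * evenProjProd g s (m + 1))
        (fusionProj (s (2 * m + 2)) (g (2 * m + 2)) (g (2 * m + 3))) :=
      ((hg.commute_oddProjProd s (by omega) (by omega) (by omega) (by omega)).mul_right
        (hg.commute_evenProjProd s (by omega) (by omega) (by omega)
          (by omega))).symm.fusionProj_right _
    have hG : Commute
        (majoranaBilinear (∏ j ∈ Finset.range (2 * m + 1), s j) (g 0) (g (2 * m + 1)))
        (fusionProj (s (2 * m + 2)) (g (2 * m + 2)) (g (2 * m + 3))) :=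
      (hg.commute_fusionProj _ (by omega) (by omega) (by omega) (by omega) (by omega) (by omega)
        (by omega) (by omega)).smul_left _
    have hG' : Commute
        (majoranaBilinear (∏ j ∈ Finset.range (2 * m + 3), s j) (g 0) (g (2 * m + 3)))
        (fusionProj (s (2 * m + 1)) (g (2 * m + 1)) (g (2 * m + 2))) :=
      (hg.commute_fusionProj _ (by omega) (by omega) (by omega) (by omega) (by omega) (by omega)
        (by omega) (by omega)).smul_left _
    have hZPe := bilinear_mul_fusionProj (hZ (2 * m + 2) (by omega))
    have hPoZ := fusionProj_mul_bilinear (hZ (2 * m + 1) (by omega))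
    simp only [add_assoc, Nat.reduceAdd] at hZPe hPoZ
    set Po := fusionProj (s (2 * m + 1)) (g (2 * m + 1)) (g (2 * m + 2))
    set Pe := fusionProj (s (2 * m + 2)) (g (2 * m + 2)) (g (2 * m + 3))
    set G := majoranaBilinear (∏ j ∈ Finset.range (2 * m + 1), s j) (g 0) (g (2 * m + 1))
    set G' := majoranaBilinear (∏ j ∈ Finset.range (2 * m + 3), s j) (g 0) (g (2 * m + 3))
    set Ze := majoranaBilinear (s (2 * m + 2)) (g (2 * m + 2)) (g (2 * m + 3))
    set Zo := majoranaBilinear (s (2 * m + 1)) (g (2 * m + 1)) (g (2 * m + 2))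
    set E := oddProjProd g s m * evenProjProd g s (m + 1) with hE
    have hX : oddProjProd g s m * Po * (evenProjProd g s (m + 1) * Pe) = Po * (Pe * E) := by
      rw [hPo.eq, ← hPe.eq, hE]
      simp only [mul_assoc]
    rw [hX]
    calc G' * (Po * (Pe * E)) = Po * (G' * (Pe * E)) := by
          rw [← mul_assoc, hG'.eq, mul_assoc]
      _ = Po * (G' * (Ze * Pe * (G * E))) := by rw [hZPe, ih]
      _ = Po * (G' * Ze * (Pe * G) * E) := by simp only [mul_assoc]
      _ = Po * (G' * Ze * G * (Pe * E)) := by rw [← hG.eq]; simp only [mul_assoc]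
      _ = Po * (Pe * E) := by rw [hkey, ← mul_assoc, hPoZ]

end Algebra

theorem isMajoranaFamily_γ (n : ℕ) [NeZero n] :
    IsMajoranaFamily (fun j : ℕ => γ n (j : ZMod (2 * n))) (2 * n) where
  sq j _ := by
    have hQ : Qform n (Pi.single (j : ZMod (2 * n)) 1) = 1 := by
      simp [Qform, QuadraticMap.weightedSumSquares_apply, Pi.single_apply]
    rw [γ, CliffordAlgebra.ι_sq_scalar, hQ, map_one]
  anti j hj k hk hjk := by
    have hne : (j : ZMod (2 * n)) ≠ k := fun h => hjk <| by
      rw [← ZMod.val_cast_of_lt hj, h, ZMod.val_cast_of_lt hk]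
    refine eq_neg_of_add_eq_zero_left ?_
    apply CliffordAlgebra.ι_mul_ι_add_swap_of_isOrtho
    rw [QuadraticMap.isOrtho_def]
    simp only [Qform, QuadraticMap.weightedSumSquares_apply, ← Finset.sum_add_distrib]
    refine Finset.sum_congr rfl fun i _ => ?_
    by_cases h₁ : i = j <;> by_cases h₂ : i = k <;> simp_all

/-- Fusion-channel lemma for the endpoint Majoranas of an open string: with
`s* = −(s_1 s_2 ⋯ s_{2n−1})` (with `0`-based indices: `s* = −∏_{j=0}^{2n−2} s_j`),
one has `(i·s*·γ_{2n} γ_1)·B'·A = B'·A`, i.e. after shifting the dimer cover along the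
open string the two newly unpaired Majoranas `γ_1` and `γ_{2n}` are fused in the channel
`i·s*·γ_{2n} γ_1 = 1`, respecting the Kasteleyn orientation. -/
theorem open_string_fusion_channel (n : ℕ) [NeZero n] (s : ZMod (2 * n) → ℂ)
    (hs : ∀ j, s j = 1 ∨ s j = -1) :
    (Complex.I * (-(∏ j ∈ Finset.range (2 * n - 1), s ((j : ℕ) : ZMod (2 * n))))) •
        (γ n ((2 * n - 1 : ℕ) : ZMod (2 * n)) * γ n 0) * (Bop' n s * Aop n s)
      = Bop' n s * Aop n s := by
  obtain ⟨m, rfl⟩ := Nat.exists_eq_succ_of_ne_zero (NeZero.ne n)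
  have h := (isMajoranaFamily_γ (m + 1)).bilinear_mul_oddProjProd_mul_evenProjProd
    (s := fun j => s j) (fun j => by rcases hs j with h | h <;> simp [h]) m (by omega)
  have hanti := (isMajoranaFamily_γ (m + 1)).anti (2 * m + 1) (by omega) 0 (by omega) (by omega)
  simp only [Nat.cast_zero] at h hanti
  have hindex : 2 * m.succ - 1 = 2 * m + 1 := by omega
  rw [hindex, hanti, mul_neg, neg_smul_neg]
  exact h
end

section
/- Phase identity underlying the duality matrix elements: let n ≥ 1 and let μ, ρ : ℤ/n → ℤ take values in {0,1}; define ν : ℤ/n → ℤ by ν(l) = (ρ(l) + μ(l) + μ(0)) mod 2 ∈ {0,1}. Then, in ℂ, ∏_{l ∈ ℤ/n} ((−i)·(−1)^{ρ(l)})^{ε(l)} = (−1)^{Σ_{l ∈ ℤ/n} μ(l)·(ν(l) + ν(l+1))}, where ε(l) = (μ(l−1) + μ(l)) mod 2 ∈ {0,1}. (This identity converts the Majorana-string phases accumulated when the Z₂ symmetry acts into the closed form (−1)^{Σ μ_l(ν_l + ν_{l+1})} of the matrix element ⟨ν|U₁₁|μ⟩.) -/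
theorem neg_one_zpow_sum {ι : Type*} (s : Finset ι) (f : ι → ℤ) :
    (-1 : ℂ) ^ (∑ i ∈ s, f i) = ∏ i ∈ s, (-1 : ℂ) ^ f i := by
  classical
  induction s using Finset.induction_on with
  | empty => simp
  | insert a s ha ih =>
    rw [Finset.sum_insert ha, Finset.prod_insert ha, zpow_add₀ (by norm_num), ih]


/-- Phase identity underlying the duality matrix elements: for binary strings
`μ, ρ : ℤ/n → {0,1}`, with `ν(l) = (ρ(l) + μ(l) + μ(0)) mod 2` and
`ε(l) = (μ(l−1) + μ(l)) mod 2`, one has, in `ℂ`,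
`∏_{l ∈ ℤ/n} ((−i)·(−1)^{ρ(l)})^{ε(l)} = (−1)^{Σ_{l ∈ ℤ/n} μ(l)·(ν(l) + ν(l+1))}`. -/
theorem duality_phase_identity (n : ℕ) [NeZero n] (μ ρ ν ε : ZMod n → ℤ)
    (hμ : ∀ l, μ l = 0 ∨ μ l = 1) (hρ : ∀ l, ρ l = 0 ∨ ρ l = 1)
    (hν : ∀ l, ν l = (ρ l + μ l + μ 0) % 2)
    (hε : ∀ l, ε l = (μ (l - 1) + μ l) % 2) :
    (∏ l : ZMod n, ((-Complex.I) * (-1 : ℂ) ^ (ρ l)) ^ (ε l))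
      = (-1 : ℂ) ^ (∑ l : ZMod n, μ l * (ν l + ν (l + 1))) := by
  set h : ZMod n → ℂ := fun l => (Complex.I * (-1 : ℂ) ^ (μ 0)) ^ (μ l) with hh
  have h_ne : ∏ l, h l ≠ 0 := Finset.prod_ne_zero_iff.mpr fun l _ =>
    zpow_ne_zero _ (mul_ne_zero Complex.I_ne_zero (zpow_ne_zero _ (by norm_num)))
  have h_shift : ∏ l, h (l - 1) = ∏ l, h l := Equiv.prod_comp (Equiv.subRight 1) h
  have exponent_shift : ∑ l, μ l * (ν l + ν (l + 1)) = ∑ l, (μ l + μ (l - 1)) * ν l := by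
    have := Equiv.sum_comp (Equiv.addRight (1 : ZMod n)) fun l => μ (l - 1) * ν l
    simp only [Equiv.coe_addRight, add_sub_cancel_right] at this
    simp only [mul_add, add_mul, Finset.sum_add_distrib, this]
  rw [exponent_shift, neg_one_zpow_sum]
  refine mul_right_cancel₀ h_ne ?_
  conv_lhs => rw [← h_shift]
  rw [← Finset.prod_mul_distrib, ← Finset.prod_mul_distrib]
  refine Finset.prod_congr rfl fun l _ => ?_
  simp only [hh, hν l, hε l]
  rcases hμ 0 with h0 | h0 <;> rcases hμ l with h1 | h1 <;> rcases hμ (l - 1) with h2 | h2 <;>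
    rcases hρ l with h3 | h3 <;> simp [h0, h1, h2, h3]
end
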